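/- Let S = K[x_1,...,x_n] over a field K and let I be a monomial ideal of S of height t. Then there exist integers a_1 ≤ a_2 ≤ ... ≤ a_t satisfying min{ j : β_{1,j}^S(S/I) ≠ 0 } ≤ a_1 and a_t ≤ max{ j : β_{1,j}^S(S/I) ≠ 0 }, and a graded ideal J of S containing x_1^{a_1},...,x_t^{a_t}, such that dim_K (S/J)_d = dim_K (S/I)_d for all d ≥ 0. -/

import Mathlib

set_option synthInstance.maxHeartbeats 1000000
set_option maxHeartbeats 1000000

open MvPolynomial

/-- `dim_K (S/I)_d`, the Hilbert function of `S/I` in degree `d`: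
the `K`-dimension of `S_d / I_d`. -/
noncomputable def hilbertFn {n : ℕ} (K : Type*) [Field K]
    (I : Ideal (MvPolynomial (Fin n) K)) (d : ℕ) : ℕ :=
  Module.finrank K
    (↥(homogeneousSubmodule (Fin n) K d) ⧸
      (Submodule.comap (homogeneousSubmodule (Fin n) K d).subtype
        (Submodule.restrictScalars K I)))

/-- A graded (homogeneous) ideal of `S = K[x₁,…,xₙ]`. -/
def IsGradedIdeal {n : ℕ} {K : Type*} [Field K] (I : Ideal (MvPolynomial (Fin n) K)) : Prop :=
  ∀ f ∈ I, ∀ d : ℕ, homogeneousComponent d f ∈ I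

/-- A monomial ideal of `S = K[x₁,…,xₙ]`: an ideal generated by monomials. -/
def IsMonomialIdeal {n : ℕ} {K : Type*} [Field K] (I : Ideal (MvPolynomial (Fin n) K)) : Prop :=
  ∃ G : Set (Fin n →₀ ℕ), I = Ideal.span ((fun s => (monomial s (1 : K))) '' G)

/-- The height of an ideal: the infimum of the heights (in the prime spectrum)
of the primes containing it. -/
noncomputable def idealHeight {R : Type*} [CommRing R] (I : Ideal R) : ℕ∞ :=
  sInf {h : ℕ∞ | ∃ p : PrimeSpectrum R, I ≤ p.asIdeal ∧ h = Order.height p}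

/-- The set of degrees of the minimal monomial generators of a monomial ideal `I`,
i.e. (for a monomial ideal) the set of internal degrees `j` with `β₁ⱼ(S/I) ≠ 0`.
A minimal monomial generator is a monomial of `I` which is minimal under divisibility
among the monomials of `I`. -/
def minGenDegrees {n : ℕ} {K : Type*} [Field K] (I : Ideal (MvPolynomial (Fin n) K)) :
    Set ℕ :=
  {j : ℕ | ∃ s : Fin n →₀ ℕ, monomial s (1 : K) ∈ I ∧
    (∀ s' : Fin n →₀ ℕ, monomial s' (1 : K) ∈ I → s' ≤ s → s' = s) ∧
    s.sum (fun _ e => e) = j}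

namespace EGH

def deg {n : ℕ} (v : Fin n → ℕ) : ℤ := ∑ i, (v i : ℤ)

def bx {n : ℕ} (c : Fin n → ℕ) (d : ℤ) : Finset (Fin n → ℕ) :=
  (Fintype.piFinset fun i => Finset.range (c i)).filter (fun v => deg v = d)

lemma mem_bx {n : ℕ} {c : Fin n → ℕ} {d : ℤ} {v : Fin n → ℕ} :
    v ∈ bx c d ↔ (∀ i, v i < c i) ∧ deg v = d := by
  simp [bx]

def lx {n : ℕ} (v w : Fin n → ℕ) : Prop := ∃ j, (∀ i < j, v i = w i) ∧ v j < w j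

lemma lx_trans {n : ℕ} {u v w : Fin n → ℕ} (h1 : lx u v) (h2 : lx v w) : lx u w := by
  obtain ⟨j, hj, hj'⟩ := h1
  obtain ⟨k, hk, hk'⟩ := h2
  rcases lt_trichotomy j k with h | h | h
  · exact ⟨j, fun i hi => (hj i hi).trans (hk i (hi.trans h)), by rw [← hk j h]; exact hj'⟩
  · subst h
    exact ⟨j, fun i hi => (hj i hi).trans (hk i hi), hj'.trans hk'⟩
  · exact ⟨k, fun i hi => (hj i (hi.trans h)).trans (hk i hi), by rw [hj k h]; exact hk'⟩

lemma lx_irrefl {n : ℕ} (u : Fin n → ℕ) : ¬ lx u u := by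
  rintro ⟨j, _, h⟩
  exact lt_irrefl _ h

lemma lx_total {n : ℕ} {u v : Fin n → ℕ} (h : u ≠ v) : lx u v ∨ lx v u := by
  have hne : (Finset.univ.filter (fun i => u i ≠ v i)).Nonempty := by
    obtain ⟨i, hi⟩ := Function.ne_iff.1 h
    exact ⟨i, by simpa using hi⟩
  obtain ⟨j, hj, hmin⟩ := Finset.exists_minimal hne
  simp only [Finset.mem_filter, Finset.mem_univ, true_and] at hj hmin
  have hlt : ∀ i < j, u i = v i := by
    intro i hi
    by_contra hc
    exact absurd (hmin hc hi.le) (not_le.2 hi)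
  rcases lt_or_gt_of_ne hj with h | h
  · exact Or.inl ⟨j, hlt, h⟩
  · exact Or.inr ⟨j, fun i hi => (hlt i hi).symm, h⟩

def inc {n : ℕ} (v : Fin n → ℕ) (j : Fin n) : Fin n → ℕ := fun i => if i = j then v i + 1 else v i
def dec {n : ℕ} (v : Fin n → ℕ) (j : Fin n) : Fin n → ℕ := fun i => if i = j then v i - 1 else v i

lemma deg_inc {n : ℕ} (v : Fin n → ℕ) (j : Fin n) : deg (inc v j) = deg v + 1 := by
  have : ∀ i, ((inc v j i : ℕ) : ℤ) = (v i : ℤ) + if i = j then 1 else 0 := by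
    intro i; unfold inc; split_ifs <;> simp
  simp [deg, this, Finset.sum_add_distrib]

lemma inc_dec {n : ℕ} (v : Fin n → ℕ) (j : Fin n) (h : 0 < v j) : inc (dec v j) j = v := by
  funext i; unfold inc dec; split_ifs with h1
  · subst h1; omega
  · rfl

lemma dec_inc {n : ℕ} (v : Fin n → ℕ) (j : Fin n) : dec (inc v j) j = v := by
  funext i; simp only [inc, dec]; split_ifs with h1 <;> simp

lemma deg_dec {n : ℕ} (v : Fin n → ℕ) (j : Fin n) (h : 0 < v j) : deg (dec v j) = deg v - 1 := by
  have := deg_inc (dec v j) j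
  rw [inc_dec v j h] at this
  omega

lemma inc_self {n : ℕ} (v : Fin n → ℕ) (j : Fin n) : inc v j j = v j + 1 := by simp [inc]
lemma inc_ne {n : ℕ} (v : Fin n → ℕ) {i j : Fin n} (h : i ≠ j) : inc v j i = v i := by simp [inc, h]
lemma dec_self {n : ℕ} (v : Fin n → ℕ) (j : Fin n) : dec v j j = v j - 1 := by simp [dec]
lemma dec_ne {n : ℕ} (v : Fin n → ℕ) {i j : Fin n} (h : i ≠ j) : dec v j i = v i := by simp [dec, h]

lemma lx_inc {n : ℕ} (v : Fin n → ℕ) (j : Fin n) : lx v (inc v j) :=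
  ⟨j, fun i hi => (inc_ne v hi.ne).symm, by rw [inc_self]; omega⟩

lemma eq_of_le_of_deg {n : ℕ} {v w : Fin n → ℕ} (h : ∀ i, v i ≤ w i) (hd : deg w ≤ deg v) :
    v = w := by
  have h1 : ∀ i ∈ Finset.univ, (v i : ℤ) ≤ w i := fun i _ => by exact_mod_cast h i
  have h2 : ∑ i, (v i : ℤ) = ∑ i, (w i : ℤ) := le_antisymm (Finset.sum_le_sum h1) hd
  have := (Finset.sum_eq_sum_iff_of_le h1).1 h2
  funext i
  exact_mod_cast this i (Finset.mem_univ i)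

/-- step down -/
lemma step_down {n : ℕ} {v m : Fin n → ℕ} (h : lx v m) (hd : deg v < deg m) :
    ∃ j, 0 < m j ∧ (v = dec m j ∨ lx v (dec m j)) := by
  obtain ⟨p, hp, hp'⟩ := h
  by_cases hex : ∃ j, p < j ∧ 0 < m j
  · obtain ⟨j, hj, hmj⟩ := hex
    refine ⟨j, hmj, Or.inr ⟨p, fun i hi => ?_, ?_⟩⟩
    · rw [dec_ne _ (hi.trans hj).ne]; exact hp i hi
    · rw [dec_ne _ hj.ne]; exact hp'
  · push Not at hex
    refine ⟨p, by omega, ?_⟩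
    by_cases hlt : v p < m p - 1
    · right
      exact ⟨p, fun i hi => by rw [dec_ne _ hi.ne]; exact hp i hi, by rw [dec_self]; exact hlt⟩
    · left
      symm
      apply eq_of_le_of_deg
      · intro i
        rcases lt_trichotomy i p with hi | hi | hi
        · rw [dec_ne _ hi.ne, hp i hi]
        · subst hi; rw [dec_self]; omega
        · rw [dec_ne _ hi.ne']; have := hex i hi; omega
      · rw [deg_dec _ _ (by omega)]; omega

open scoped Classical in
noncomputable def sh {n : ℕ} (c : Fin n → ℕ) (d : ℤ) (A : Finset (Fin n → ℕ)) :
    Finset (Fin n → ℕ) :=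
  (bx c (d+1)).filter (fun w => ∃ v ∈ A, ∃ j, w = inc v j)

lemma mem_sh {n : ℕ} {c : Fin n → ℕ} {d : ℤ} {A : Finset (Fin n → ℕ)} {w : Fin n → ℕ} :
    w ∈ sh c d A ↔ w ∈ bx c (d+1) ∧ ∃ v ∈ A, ∃ j, w = inc v j := by
  simp [sh]

lemma sh_mono {n : ℕ} {c : Fin n → ℕ} {d : ℤ} {A B : Finset (Fin n → ℕ)} (h : A ⊆ B) :
    sh c d A ⊆ sh c d B := by
  intro w hw
  rw [mem_sh] at *
  obtain ⟨h1, v, hv, j, rfl⟩ := hw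
  exact ⟨h1, v, h hv, j, rfl⟩

def IsSeg {n : ℕ} (c : Fin n → ℕ) (d : ℤ) (L : Finset (Fin n → ℕ)) : Prop :=
  L ⊆ bx c d ∧ ∀ v ∈ L, ∀ w ∈ bx c d, lx v w → w ∈ L

lemma dec_mem_bx {n : ℕ} {c : Fin n → ℕ} {d : ℤ} {m : Fin n → ℕ} {j : Fin n}
    (h : m ∈ bx c (d+1)) (hj : 0 < m j) : dec m j ∈ bx c d := by
  rw [mem_bx] at *
  refine ⟨fun i => ?_, by rw [deg_dec _ _ hj]; omega⟩
  have := h.1 i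
  unfold dec; split_ifs <;> omega

lemma sh_seg {n : ℕ} {c : Fin n → ℕ} {d : ℤ} {L : Finset (Fin n → ℕ)} (h : IsSeg c d L) :
    IsSeg c (d+1) (sh c d L) := by
  refine ⟨Finset.filter_subset _ _, ?_⟩
  intro w hw m hm hwm
  rw [mem_sh] at hw
  obtain ⟨h1, v, hv, j, rfl⟩ := hw
  have hvm : lx v m := lx_trans (lx_inc v j) hwm
  have hdv := (mem_bx.1 (h.1 hv)).2
  have hdm := (mem_bx.1 hm).2
  obtain ⟨i, hi, hor⟩ := step_down hvm (by omega)
  rw [mem_sh]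
  refine ⟨hm, dec m i, ?_, i, (inc_dec m i hi).symm⟩
  rcases hor with e | e
  · rw [← e]; exact hv
  · exact h.2 v hv _ (dec_mem_bx hm hi) e

lemma seg_sub_or {n : ℕ} {c : Fin n → ℕ} {d : ℤ} {L M : Finset (Fin n → ℕ)}
    (hL : IsSeg c d L) (hM : IsSeg c d M) : L ⊆ M ∨ M ⊆ L := by
  by_contra hc
  push Not at hc
  obtain ⟨⟨u, hu, hu'⟩, ⟨v, hv, hv'⟩⟩ := And.intro (Finset.not_subset.1 hc.1) (Finset.not_subset.1 hc.2)
  have hne : u ≠ v := by rintro rfl; exact hu' hv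
  rcases lx_total hne with h | h
  · exact hv' (hL.2 u hu v (hM.1 hv) h)
  · exact hu' (hM.2 v hv u (hL.1 hu) h)

lemma seg_sub {n : ℕ} {c : Fin n → ℕ} {d : ℤ} {L M : Finset (Fin n → ℕ)}
    (hL : IsSeg c d L) (hM : IsSeg c d M) (h : L.card ≤ M.card) : L ⊆ M := by
  rcases seg_sub_or hL hM with h' | h'
  · exact h'
  · rw [Finset.eq_of_subset_of_card_le h' h]

lemma exists_lx_max {n : ℕ} (T : Finset (Fin n → ℕ)) (h : T.Nonempty) :
    ∃ m ∈ T, ∀ w ∈ T, w ≠ m → lx w m := by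
  classical
  induction h using Finset.Nonempty.cons_induction with
  | singleton a => exact ⟨a, by simp, by simp⟩
  | cons a s ha hs ih =>
    obtain ⟨m, hm, hmax⟩ := ih
    have hne : a ≠ m := by rintro rfl; exact ha hm
    rcases lx_total hne with h | h
    · refine ⟨m, by simp [hm], ?_⟩
      intro w hw hwm
      rcases Finset.mem_cons.1 hw with rfl | hw
      · exact h
      · exact hmax w hw hwm
    · refine ⟨a, by simp, ?_⟩
      intro w hw hwm
      rcases Finset.mem_cons.1 hw with rfl | hw
      · exact absurd rfl hwm
      · by_cases e : w = m
        · rw [e]; exact h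
        · exact lx_trans (hmax w hw e) h

lemma seg_exists {n : ℕ} (c : Fin n → ℕ) (d : ℤ) (N : ℕ) (hN : N ≤ (bx c d).card) :
    ∃ L, IsSeg c d L ∧ L.card = N := by
  classical
  induction N with
  | zero => exact ⟨∅, ⟨by simp, by simp⟩, by simp⟩
  | succ N ih =>
    obtain ⟨L, hL, hc⟩ := ih (by omega)
    have hne : (bx c d \ L).Nonempty := by
      rw [← Finset.card_pos, Finset.card_sdiff_of_subset hL.1]; omega
    obtain ⟨m, hm, hmax⟩ := exists_lx_max _ hne
    rw [Finset.mem_sdiff] at hm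
    refine ⟨insert m L, ⟨?_, ?_⟩, by rw [Finset.card_insert_of_notMem hm.2, hc]⟩
    · intro w hw
      rcases Finset.mem_insert.1 hw with rfl | hw
      · exact hm.1
      · exact hL.1 hw
    · intro v hv w hw hvw
      rw [Finset.mem_insert]
      by_contra hcon
      push Not at hcon
      rcases Finset.mem_insert.1 hv with rfl | hv
      · exact lx_irrefl _ (lx_trans hvw (hmax w (by simp [hw, hcon.2]) hcon.1))
      · exact hcon.2 (hL.2 v hv w hw hvw)

/-- step up -/
lemma step_up {m : ℕ} {c w z : Fin (m+1) → ℕ} (hz : ∀ i, z i < c i) (h : lx w z)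
    (hd : deg w = deg z) (hl : z (Fin.last m) < w (Fin.last m)) :
    ∃ j, j ≠ Fin.last m ∧ w j + 1 < c j ∧
      (dec (inc w j) (Fin.last m) = z ∨ lx (dec (inc w j) (Fin.last m)) z) := by
  obtain ⟨p, hp, hp'⟩ := h
  have hpl : p < Fin.last m := by
    rw [Fin.lt_last_iff_ne_last]; rintro rfl; omega
  by_cases hex : ∃ j, p < j ∧ j < Fin.last m ∧ w j + 1 < c j
  · obtain ⟨j, hj, hjl, hmj⟩ := hex
    refine ⟨j, hjl.ne, hmj, Or.inr ⟨p, fun i hi => ?_, ?_⟩⟩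
    · rw [dec_ne _ (hi.trans hpl).ne, inc_ne _ (hi.trans hj).ne]; exact hp i hi
    · rw [dec_ne _ hpl.ne, inc_ne _ hj.ne]; exact hp'
  · push Not at hex
    refine ⟨p, hpl.ne, by have := hz p; omega, ?_⟩
    by_cases hlt : w p + 1 < z p
    · right
      refine ⟨p, fun i hi => ?_, ?_⟩
      · rw [dec_ne _ (hi.trans hpl).ne, inc_ne _ hi.ne]; exact hp i hi
      · rw [dec_ne _ hpl.ne, inc_self]; exact hlt
    · left
      symm
      apply eq_of_le_of_deg
      · intro i
        by_cases hil : i = Fin.last m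
        · subst hil; rw [dec_self, inc_ne _ hpl.ne']; omega
        rw [dec_ne _ hil]
        rcases lt_trichotomy i p with hi | hi | hi
        · rw [inc_ne _ hi.ne, hp i hi]
        · subst hi; rw [inc_self]; omega
        · rw [inc_ne _ hi.ne']
          have := hex i hi (Fin.lt_last_iff_ne_last.2 hil)
          have := hz i; omega
      · rw [deg_dec _ _ (by rw [inc_ne _ hpl.ne']; omega), deg_inc]; omega

def Cmp {n : ℕ} (c : Fin n → ℕ) (d : ℤ) (A : Finset (Fin n → ℕ)) (i : Fin n) : Prop :=
  ∀ w ∈ A, ∀ z ∈ bx c d, z i = w i → lx w z → z ∈ A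

def Exch {m : ℕ} (c : Fin (m+1) → ℕ) (A : Finset (Fin (m+1) → ℕ)) : Prop :=
  ∀ w ∈ A, 0 < w (Fin.last m) → ∀ j, j ≠ Fin.last m → w j + 1 < c j →
    dec (inc w j) (Fin.last m) ∈ A

lemma exch_mem_bx {m : ℕ} {c : Fin (m+1) → ℕ} {d : ℤ} {w : Fin (m+1) → ℕ} (hw : w ∈ bx c d)
    (h0 : 0 < w (Fin.last m)) {j : Fin (m+1)} (hj : j ≠ Fin.last m) (hc : w j + 1 < c j) :
    dec (inc w j) (Fin.last m) ∈ bx c d := by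
  have : inc w j ∈ bx c (d+1) := by
    rw [mem_bx] at *
    refine ⟨fun i => ?_, by rw [deg_inc, hw.2]⟩
    by_cases h : i = j
    · subst h; rw [inc_self]; exact hc
    · rw [inc_ne _ h]; exact hw.1 i
  exact dec_mem_bx this (by rw [inc_ne _ hj.symm]; exact h0)

lemma exch_lx {m : ℕ} (w : Fin (m+1) → ℕ) {j : Fin (m+1)} (hj : j ≠ Fin.last m) :
    lx w (dec (inc w j) (Fin.last m)) := by
  have hjl := Fin.lt_last_iff_ne_last.2 hj
  refine ⟨j, fun i hi => ?_, ?_⟩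
  · rw [dec_ne _ (hi.trans hjl).ne, inc_ne _ hi.ne]
  · rw [dec_ne _ hj, inc_self]; omega

lemma seg_exch {m : ℕ} {c : Fin (m+1) → ℕ} {d : ℤ} {L : Finset (Fin (m+1) → ℕ)}
    (hL : IsSeg c d L) : Exch c L := fun w hw h0 _ hj hc =>
  hL.2 w hw _ (exch_mem_bx (hL.1 hw) h0 hj hc) (exch_lx w hj)

lemma cmp_exch {m : ℕ} (hm : 2 ≤ m) {c : Fin (m+1) → ℕ} {d : ℤ} {A : Finset (Fin (m+1) → ℕ)}
    (hA : A ⊆ bx c d) (hC : ∀ i, Cmp c d A i) : Exch c A := by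
  intro w hw h0 j hj hc
  obtain ⟨i, hi1, hi2⟩ : ∃ i, i ≠ j ∧ i ≠ Fin.last m := by
    by_cases h : j = 0
    · refine ⟨⟨1, by omega⟩, ?_, ?_⟩
      · subst h; simp [Fin.ext_iff]
      · simp [Fin.ext_iff]; omega
    · exact ⟨0, fun e => h e.symm, by simp [Fin.ext_iff]; omega⟩
  refine hC i w hw _ (exch_mem_bx (hA hw) h0 hj hc) ?_ (exch_lx w hj)
  rw [dec_ne _ hi2, inc_ne _ hi1]

lemma T_prop {m : ℕ} {c : Fin (m+1) → ℕ} {d : ℤ} {A : Finset (Fin (m+1) → ℕ)}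
    (hA : A ⊆ bx c d) (hC : Cmp c d A (Fin.last m)) (hE : Exch c A) (r : ℕ) :
    ∀ w ∈ A, ∀ z ∈ bx c d, w (Fin.last m) = z (Fin.last m) + r → lx w z → z ∈ A := by
  induction r with
  | zero => intro w hw z hz h hl; exact hC w hw z hz (by omega) hl
  | succ r ih =>
    intro w hw z hz h hl
    have hz' := mem_bx.1 hz
    obtain ⟨j, hj, hjc, hor⟩ := step_up hz'.1 hl ((mem_bx.1 (hA hw)).2.trans hz'.2.symm) (by omega)
    have hmem := hE w hw (by omega) j hj hjc
    rcases hor with e | e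
    · rw [← e]; exact hmem
    · refine ih _ hmem z hz ?_ e
      rw [dec_self, inc_ne _ hj.symm]; omega

lemma sh_card {m : ℕ} {c : Fin (m+1) → ℕ} {d : ℤ} {A : Finset (Fin (m+1) → ℕ)}
    (hA : A ⊆ bx c d) (hE : Exch c A) :
    (sh c d A).card = ((sh c d A).filter (fun w => w (Fin.last m) = 0)).card +
      (A.filter (fun v => v (Fin.last m) + 1 < c (Fin.last m))).card := by
  classical
  rw [← Finset.card_filter_add_card_filter_not (fun w : Fin (m+1) → ℕ => w (Fin.last m) = 0)]
  congr 1
  symm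
  apply Finset.card_bij (fun v _ => inc v (Fin.last m))
  · intro v hv
    rw [Finset.mem_filter] at hv
    have hb := mem_bx.1 (hA hv.1)
    rw [Finset.mem_filter, mem_sh, mem_bx, inc_self, deg_inc, hb.2]
    refine ⟨⟨⟨fun i => ?_, rfl⟩, v, hv.1, _, rfl⟩, by omega⟩
    by_cases h : i = Fin.last m
    · subst h; rw [inc_self]; exact hv.2
    · rw [inc_ne _ h]; exact hb.1 i
  · intro v _ w _ h
    rw [← dec_inc v (Fin.last m), h, dec_inc]
  · intro w hw
    rw [Finset.mem_filter, mem_sh] at hw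
    obtain ⟨⟨hwb, v, hv, j, rfl⟩, h0⟩ := hw
    have hb := (mem_bx.1 hwb).1
    refine ⟨dec (inc v j) (Fin.last m), ?_, inc_dec _ _ (by omega)⟩
    rw [Finset.mem_filter]
    refine ⟨?_, by rw [dec_self]; have := hb (Fin.last m); omega⟩
    by_cases h : j = Fin.last m
    · subst h; rw [dec_inc]; exact hv
    · refine hE v hv ?_ j h ?_
      · rw [inc_ne _ (Ne.symm h)] at h0; omega
      · have := hb j; rw [inc_self] at this; exact this

lemma final_compare {m : ℕ} {c : Fin (m+1) → ℕ} {d : ℤ} {A L : Finset (Fin (m+1) → ℕ)}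
    (hA : A ⊆ bx c d) (hC : Cmp c d A (Fin.last m)) (hE : Exch c A)
    (hL : IsSeg c d L) (hcard : L.card = A.card) : (sh c d L).card ≤ (sh c d A).card := by
  classical
  have h1 : ∀ u ∈ L, u (Fin.last m) = 0 → u ∈ A := by
    intro u hu hu0
    by_contra hc
    have hsub : A ⊆ L := by
      intro w hw
      by_cases e : w = u
      · rw [e]; exact hu
      rcases lx_total e with h | h
      · exact absurd (T_prop hA hC hE (w (Fin.last m)) w hw u (hL.1 hu) (by omega) h) hc
      · exact hL.2 u hu w (hA hw) h
    rw [Finset.eq_of_subset_of_card_le hsub hcard.le] at hc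
    exact hc hu
  have h2 : ∀ v ∈ A, ¬ (v (Fin.last m) + 1 < c (Fin.last m)) → v ∈ L := by
    intro v hv htop
    by_contra hc
    have hsub : L ⊆ A := by
      intro w hw
      by_cases e : w = v
      · rw [e]; exact hv
      rcases lx_total e with h | h
      · exact absurd (hL.2 w hw v (hA hv) h) hc
      · have := (mem_bx.1 (hL.1 hw)).1 (Fin.last m)
        exact T_prop hA hC hE (v (Fin.last m) - w (Fin.last m)) v hv w (hL.1 hw) (by omega) h
    rw [← Finset.eq_of_subset_of_card_le hsub hcard.ge] at hv
    exact hc hv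
  rw [sh_card hA hE, sh_card hL.1 (seg_exch hL)]
  apply add_le_add
  · apply Finset.card_le_card
    intro w hw
    rw [Finset.mem_filter, mem_sh] at *
    obtain ⟨⟨hwb, v, hv, j, rfl⟩, h0⟩ := hw
    refine ⟨⟨hwb, v, h1 v hv ?_, j, rfl⟩, h0⟩
    unfold inc at h0
    split_ifs at h0
    exact h0
  · have e1 := Finset.card_filter_add_card_filter_not (s := A) (fun v : Fin (m+1) → ℕ => v (Fin.last m) + 1 < c (Fin.last m))
    have e2 := Finset.card_filter_add_card_filter_not (s := L) (fun v : Fin (m+1) → ℕ => v (Fin.last m) + 1 < c (Fin.last m))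
    have e3 : (A.filter (fun v => ¬ (v (Fin.last m) + 1 < c (Fin.last m)))).card ≤
        (L.filter (fun v => ¬ (v (Fin.last m) + 1 < c (Fin.last m)))).card := by
      apply Finset.card_le_card
      intro v hv
      rw [Finset.mem_filter] at *
      exact ⟨h2 v hv.1 hv.2, hv.2⟩
    omega

lemma deg_two (v : Fin 2 → ℕ) : deg v = v 0 + v 1 := by simp [deg]

lemma ext_two {v w : Fin 2 → ℕ} (h0 : v 0 = w 0) (h1 : v 1 = w 1) : v = w := by
  funext i; fin_cases i
  · exact h0
  · exact h1

lemma mem_bx_two {c : Fin 2 → ℕ} {d : ℤ} {v : Fin 2 → ℕ} :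
    v ∈ bx c d ↔ v 0 < c 0 ∧ v 1 < c 1 ∧ (v 0 : ℤ) + v 1 = d := by
  rw [mem_bx, deg_two, Fin.forall_fin_two, and_assoc]

lemma inc_two (v : Fin 2 → ℕ) : inc v 0 0 = v 0 + 1 ∧ inc v 0 1 = v 1 ∧ inc v 1 0 = v 0 ∧
    inc v 1 1 = v 1 + 1 := by simp [inc]

lemma seg_two {c : Fin 2 → ℕ} {d : ℤ} {L : Finset (Fin 2 → ℕ)} (hL : IsSeg c d L)
    {w : Fin 2 → ℕ} (hw : w ∈ sh c d L) (h0 : 0 < w 1) : dec w 1 ∈ L := by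
  rw [mem_sh] at hw
  obtain ⟨hwb, v, hv, j, rfl⟩ := hw
  fin_cases j
  · refine hL.2 v hv _ (dec_mem_bx hwb h0) ⟨0, ?_, ?_⟩
    · intro i hi; exact absurd hi (by simp)
    · simp [dec, inc]
  · change dec (inc v 1) 1 ∈ L
    rw [dec_inc]; exact hv

lemma CL_two {c : Fin 2 → ℕ} (hc : c 0 ≤ c 1) {d : ℤ} {A L : Finset (Fin 2 → ℕ)}
    (hA : A ⊆ bx c d) (hL : IsSeg c d L) (hcard : L.card = A.card) :
    (sh c d L).card ≤ (sh c d A).card := by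
  classical
  by_cases hall : A = bx c d
  · have : L = A := by
      rw [hall]; exact Finset.eq_of_subset_of_card_le hL.1 (by rw [← hall, hcard])
    rw [this]
  rcases A.eq_empty_or_nonempty with rfl | hne
  · have : L = ∅ := by simpa using hcard
    rw [this]
  by_cases hd : d + 1 < c 0
  · have h1 : (sh c d L).card ≤ L.card + 1 := by
      have hs : sh c d L ⊆ insert ![(d+1).toNat, 0] (L.image (fun v => inc v 1)) := by
        intro w hw
        rw [Finset.mem_insert, Finset.mem_image]
        by_cases h0 : 0 < w 1
        · exact Or.inr ⟨dec w 1, seg_two hL hw h0, inc_dec _ _ h0⟩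
        · left
          have hb := mem_bx_two.1 (mem_sh.1 hw).1
          apply ext_two
          · simp; omega
          · simp; omega
      refine (Finset.card_le_card hs).trans ((Finset.card_insert_le _ _).trans ?_)
      exact Nat.add_le_add_right Finset.card_image_le 1
    have h2 : A.card + 1 ≤ (sh c d A).card := by
      obtain ⟨x, hx, hmax⟩ := exists_lx_max A hne
      have hnot : inc x 0 ∉ A.image (fun v => inc v 1) := by
        intro hmem
        obtain ⟨y, hy, hxy⟩ := Finset.mem_image.1 hmem
        have e0 := congrFun hxy 0
        simp only [inc_two] at e0
        have hlt : lx x y := ⟨0, fun i hi => absurd hi (by simp), by omega⟩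
        have hne : y ≠ x := by rintro rfl; exact lx_irrefl _ hlt
        exact lx_irrefl _ (lx_trans hlt (hmax y hy hne))
      have hinj : (A.image (fun v => inc v 1)).card = A.card := by
        apply Finset.card_image_of_injective
        intro v w h
        have h' : inc v 1 = inc w 1 := h
        rw [← dec_inc v 1, h', dec_inc]
      rw [← hinj, ← Finset.card_insert_of_notMem hnot]
      apply Finset.card_le_card
      intro w hw
      rw [mem_sh, mem_bx_two]
      rcases Finset.mem_insert.1 hw with rfl | hw
      · have hb := mem_bx_two.1 (hA hx)
        refine ⟨?_, x, hx, 0, rfl⟩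
        simp only [inc_two]; omega
      · obtain ⟨y, hy, rfl⟩ := Finset.mem_image.1 hw
        have hb := mem_bx_two.1 (hA hy)
        refine ⟨?_, y, hy, 1, rfl⟩
        simp only [inc_two]; omega
    omega
  · have h1 : (sh c d L).card ≤ L.card := by
      have hs : sh c d L ⊆ L.image (fun v => inc v 1) := by
        intro w hw
        rw [Finset.mem_image]
        have hb := mem_bx_two.1 (mem_sh.1 hw).1
        have h0 : 0 < w 1 := by omega
        exact ⟨dec w 1, seg_two hL hw h0, inc_dec _ _ h0⟩
      exact (Finset.card_le_card hs).trans Finset.card_image_le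
    obtain ⟨p, hp, hpA⟩ : ∃ p ∈ bx c d, p ∉ A := by
      by_contra hcon
      push Not at hcon
      exact hall (Finset.Subset.antisymm hA hcon)
    have hpb := mem_bx_two.1 hp
    have h2 : A.card ≤ (sh c d A).card := by
      apply Finset.card_le_card_of_injOn (fun v => if p 0 < v 0 then inc v 1 else inc v 0)
      · intro v hv
        have hv : v ∈ A := hv
        have hb := mem_bx_two.1 (hA hv)
        simp only [Finset.mem_coe]
        split_ifs with h
        · rw [mem_sh, mem_bx_two]
          refine ⟨?_, v, hv, 1, rfl⟩
          simp only [inc_two]; omega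
        · rw [mem_sh, mem_bx_two]
          refine ⟨?_, v, hv, 0, rfl⟩
          have hne : v 0 ≠ p 0 := by
            intro e
            apply hpA
            have : p = v := ext_two e.symm (by omega)
            rw [this]; exact hv
          simp only [inc_two]; omega
      · intro v hv w hw h
        have hbv := mem_bx_two.1 (hA hv)
        have hbw := mem_bx_two.1 (hA hw)
        have hnv : v 0 ≠ p 0 := by
          intro e; apply hpA
          have : p = v := ext_two e.symm (by omega)
          rw [this]; exact hv
        have hnw : w 0 ≠ p 0 := by
          intro e; apply hpA
          have : p = w := ext_two e.symm (by omega)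
          rw [this]; exact hw
        simp only at h
        have e0 := congrFun h 0
        have e1 := congrFun h 1
        split_ifs at e0 e1 <;> simp only [inc_two] at e0 e1 <;> apply ext_two <;> omega
    omega

lemma CL_small {n : ℕ} (hn : n ≤ 1) {c : Fin n → ℕ} {d : ℤ} {A L : Finset (Fin n → ℕ)}
    (hA : A ⊆ bx c d) (hL : IsSeg c d L) (hcard : L.card = A.card) :
    (sh c d L).card ≤ (sh c d A).card := by
  have hsub : ∀ v ∈ bx c d, ∀ w ∈ bx c d, v = w := by
    intro v hv w hw
    have h1 := (mem_bx.1 hv).2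
    have h2 := (mem_bx.1 hw).2
    interval_cases n
    · exact Subsingleton.elim _ _
    · simp [deg] at h1 h2
      funext i
      have : i = 0 := Subsingleton.elim _ _
      subst this
      have := h1.trans h2.symm
      exact_mod_cast this
  have : L = A := by
    have hle : (bx c d).card ≤ 1 := Finset.card_le_one.2 hsub
    rcases A.eq_empty_or_nonempty with rfl | hne
    · simpa using hcard
    · have := hne.card_pos
      rw [Finset.eq_of_subset_of_card_le hA (by omega), Finset.eq_of_subset_of_card_le hL.1 (by omega)]
  rw [this]

def ins {m : ℕ} (i : Fin (m+1)) (k : ℕ) (v : Fin m → ℕ) : Fin (m+1) → ℕ :=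
  Fin.insertNth (α := fun _ => ℕ) i k v

def rm {m : ℕ} (i : Fin (m+1)) (w : Fin (m+1) → ℕ) : Fin m → ℕ := fun j => w (i.succAbove j)

lemma ins_same {m : ℕ} (i : Fin (m+1)) (k : ℕ) (v : Fin m → ℕ) : ins i k v i = k := by
  simp [ins]

lemma ins_sa {m : ℕ} (i : Fin (m+1)) (k : ℕ) (v : Fin m → ℕ) (j : Fin m) :
    ins i k v (i.succAbove j) = v j := by
  simp [ins]

lemma rm_ins {m : ℕ} (i : Fin (m+1)) (k : ℕ) (v : Fin m → ℕ) : rm i (ins i k v) = v := by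
  funext j; simp [rm, ins_sa]

lemma fin_cases_sa {m : ℕ} (i j : Fin (m+1)) : j = i ∨ ∃ l, j = i.succAbove l := by
  by_cases h : j = i
  · exact Or.inl h
  · obtain ⟨l, hl⟩ := Fin.exists_succAbove_eq h
    exact Or.inr ⟨l, hl.symm⟩

lemma ins_rm {m : ℕ} (i : Fin (m+1)) (w : Fin (m+1) → ℕ) : ins i (w i) (rm i w) = w := by
  funext j
  rcases fin_cases_sa i j with rfl | ⟨l, rfl⟩
  · rw [ins_same]
  · rw [ins_sa]; rfl

lemma deg_ins {m : ℕ} (i : Fin (m+1)) (k : ℕ) (v : Fin m → ℕ) : deg (ins i k v) = k + deg v := by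
  simp [deg, Fin.sum_univ_succAbove _ i, ins_same, ins_sa]

lemma ins_mem_bx {m : ℕ} {c : Fin (m+1) → ℕ} {d : ℤ} {i : Fin (m+1)} {k : ℕ} {v : Fin m → ℕ} :
    ins i k v ∈ bx c d ↔ k < c i ∧ v ∈ bx (rm i c) (d - k) := by
  rw [mem_bx, mem_bx, deg_ins, Fin.forall_iff_succAbove i, ins_same, and_assoc]
  simp only [ins_sa]
  refine and_congr_right fun _ => and_congr Iff.rfl ?_
  constructor <;> intro h <;> omega

lemma lx_ins {m : ℕ} {i : Fin (m+1)} {k : ℕ} {v w : Fin m → ℕ} (h : lx v w) :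
    lx (ins i k v) (ins i k w) := by
  obtain ⟨j, hj, hj'⟩ := h
  refine ⟨i.succAbove j, fun l hl => ?_, by rw [ins_sa, ins_sa]; exact hj'⟩
  rcases fin_cases_sa i l with rfl | ⟨l, rfl⟩
  · rw [ins_same, ins_same]
  · rw [ins_sa, ins_sa]
    exact hj l ((Fin.strictMono_succAbove i).lt_iff_lt.1 hl)

lemma lx_rm {m : ℕ} {i : Fin (m+1)} {w z : Fin (m+1) → ℕ} (h : lx w z) (he : z i = w i) :
    lx (rm i w) (rm i z) := by
  have hne : rm i w ≠ rm i z := by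
    intro e
    have : w = z := by rw [← ins_rm i w, ← ins_rm i z, e, he]
    rw [this] at h
    exact lx_irrefl _ h
  rcases lx_total hne with h' | h'
  · exact h'
  · have := lx_ins (i := i) (k := w i) h'
    rw [ins_rm, ← he, ins_rm] at this
    exact absurd (lx_trans h this) (lx_irrefl _)

def stack {m : ℕ} (i : Fin (m+1)) (c : Fin (m+1) → ℕ) (d : ℤ) (L : ℕ → Finset (Fin m → ℕ)) :
    Finset (Fin (m+1) → ℕ) :=
  (bx c d).filter (fun w => rm i w ∈ L (w i))

lemma mem_stack {m : ℕ} {i : Fin (m+1)} {c : Fin (m+1) → ℕ} {d : ℤ} {L : ℕ → Finset (Fin m → ℕ)}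
    {w : Fin (m+1) → ℕ} : w ∈ stack i c d L ↔ w ∈ bx c d ∧ rm i w ∈ L (w i) := by
  simp [stack]

lemma sum_stack {m : ℕ} {i : Fin (m+1)} {c : Fin (m+1) → ℕ} {d : ℤ} {L : ℕ → Finset (Fin m → ℕ)}
    (hL : ∀ k : ℕ, L k ⊆ bx (rm i c) (d - k)) (g : (Fin (m+1) → ℕ) → ℕ) :
    ∑ w ∈ stack i c d L, g w = ∑ k ∈ Finset.range (c i), ∑ v ∈ L k, g (ins i k v) := by
  rw [Finset.sum_sigma']
  symm
  refine Finset.sum_bij' (fun x _ => ins i x.1 x.2) (fun w _ => ⟨w i, rm i w⟩) ?_ ?_ ?_ ?_ ?_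
  · rintro ⟨k, v⟩ h
    rw [Finset.mem_sigma, Finset.mem_range] at h
    rw [mem_stack, ins_mem_bx, rm_ins, ins_same]
    exact ⟨⟨h.1, hL k h.2⟩, h.2⟩
  · intro w h
    rw [mem_stack] at h
    rw [Finset.mem_sigma, Finset.mem_range]
    exact ⟨(mem_bx.1 h.1).1 i, h.2⟩
  · rintro ⟨k, v⟩ h
    simp only [rm_ins, ins_same]
  · intro w h
    simp only [ins_rm]
  · rintro ⟨k, v⟩ h
    rfl

lemma card_stack {m : ℕ} {i : Fin (m+1)} {c : Fin (m+1) → ℕ} {d : ℤ} {L : ℕ → Finset (Fin m → ℕ)}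
    (hL : ∀ k : ℕ, L k ⊆ bx (rm i c) (d - k)) :
    (stack i c d L).card = ∑ k ∈ Finset.range (c i), (L k).card := by
  have := sum_stack hL (fun _ => 1)
  simpa using this

lemma inc_sa {m : ℕ} (i : Fin (m+1)) (w : Fin (m+1) → ℕ) (j : Fin m) :
    rm i (inc w (i.succAbove j)) = inc (rm i w) j := by
  funext l
  simp [rm, inc]

lemma sh_stack {m : ℕ} {i : Fin (m+1)} {c : Fin (m+1) → ℕ} {d : ℤ} {L M : ℕ → Finset (Fin m → ℕ)}
    (h1 : ∀ k : ℕ, k < c i → sh (rm i c) (d - k) (L k) ⊆ M k)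
    (h2 : ∀ k : ℕ, k + 1 < c i → L k ⊆ M (k+1)) :
    sh c d (stack i c d L) ⊆ stack i c (d+1) M := by
  intro w hw
  rw [mem_sh] at hw
  obtain ⟨hwb, v, hv, j, rfl⟩ := hw
  rw [mem_stack] at hv
  rw [mem_stack]
  refine ⟨hwb, ?_⟩
  rcases fin_cases_sa i j with rfl | ⟨l, rfl⟩
  · have hk := (mem_bx.1 hwb).1 j
    rw [inc_self] at hk ⊢
    have : rm j (inc v j) = rm j v := by
      funext l; simp [rm, inc, Fin.succAbove_ne]
    rw [this]
    exact h2 _ hk hv.2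
  · rw [inc_sa, inc_ne _ (Fin.succAbove_ne i l).symm]
    apply h1 _ ((mem_bx.1 hv.1).1 i)
    rw [mem_sh]
    refine ⟨?_, _, hv.2, l, rfl⟩
    rw [← ins_rm i (inc v _), ins_mem_bx, inc_sa, inc_ne _ (Fin.succAbove_ne i l).symm] at hwb
    rw [show d + 1 - (v i : ℤ) = d - v i + 1 by ring] at hwb
    exact hwb.2

def slice {m : ℕ} (i : Fin (m+1)) (c : Fin (m+1) → ℕ) (d : ℤ) (A : Finset (Fin (m+1) → ℕ)) (k : ℕ) :
    Finset (Fin m → ℕ) := (bx (rm i c) (d - k)).filter (fun v => ins i k v ∈ A)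

lemma stack_slice {m : ℕ} {i : Fin (m+1)} {c : Fin (m+1) → ℕ} {d : ℤ} {A : Finset (Fin (m+1) → ℕ)}
    (hA : A ⊆ bx c d) : stack i c d (slice i c d A) = A := by
  ext w
  rw [mem_stack, slice, Finset.mem_filter, ins_rm]
  constructor
  · intro h; exact h.2.2
  · intro h
    have hb := hA h
    refine ⟨hb, ?_, h⟩
    rw [← ins_rm i w, ins_mem_bx] at hb
    exact hb.2

lemma seg_sum {n : ℕ} {c : Fin n → ℕ} {d : ℤ} {A L : Finset (Fin n → ℕ)} (hL : IsSeg c d L)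
    (hA : A ⊆ bx c d) (hcard : L.card = A.card) (r : (Fin n → ℕ) → ℕ)
    (hr : ∀ v ∈ bx c d, ∀ w ∈ bx c d, lx v w → r w < r v) :
    L = A ∨ ∑ v ∈ L, r v < ∑ v ∈ A, r v := by
  classical
  by_cases he : L = A
  · exact Or.inl he
  right
  have hc : (L \ A).card = (A \ L).card := Finset.card_sdiff_comm hcard
  have hne : (A \ L).Nonempty := by
    rw [Finset.sdiff_nonempty]
    intro h
    exact he (Finset.eq_of_subset_of_card_le h hcard.le).symm
  have hne' : (L \ A).Nonempty := by
    rw [← Finset.card_pos, hc]; exact hne.card_pos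
  obtain ⟨y, hy, hmin⟩ := Finset.exists_min_image (A \ L) r hne
  rw [← Finset.sum_sdiff_lt_sum_sdiff]
  calc ∑ v ∈ L \ A, r v < ∑ v ∈ L \ A, r y := by
        apply Finset.sum_lt_sum_of_nonempty hne'
        intro x hx
        rw [Finset.mem_sdiff] at hx hy
        have hne : x ≠ y := by rintro rfl; exact hx.2 hy.1
        rcases lx_total hne with h | h
        · exact absurd (hL.2 x hx.1 y (hA hy.1) h) hy.2
        · exact hr y (hA hy.1) x (hL.1 hx.1) h
    _ = (A \ L).card • r y := by rw [Finset.sum_const, hc]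
    _ ≤ ∑ v ∈ A \ L, r v := Finset.card_nsmul_le_sum _ _ _ hmin

def CL (n : ℕ) : Prop := ∀ (c : Fin n → ℕ), Monotone c → ∀ (d : ℤ) (A L : Finset (Fin n → ℕ)),
  A ⊆ bx c d → IsSeg c d L → L.card = A.card → (sh c d L).card ≤ (sh c d A).card

lemma rm_mono {m : ℕ} {c : Fin (m+1) → ℕ} (hc : Monotone c) (i : Fin (m+1)) : Monotone (rm i c) :=
  fun _ _ h => hc ((Fin.strictMono_succAbove i).monotone h)

lemma compress {m : ℕ} (hCL : CL m) {c : Fin (m+1) → ℕ} (hc : Monotone c) {d : ℤ} (i : Fin (m+1))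
    {A : Finset (Fin (m+1) → ℕ)} (hA : A ⊆ bx c d) (r : (Fin (m+1) → ℕ) → ℕ)
    (hr : ∀ v ∈ bx c d, ∀ w ∈ bx c d, lx v w → r w < r v) :
    ∃ A' ⊆ bx c d, A'.card = A.card ∧ (sh c d A').card ≤ (sh c d A).card ∧ Cmp c d A' i ∧
      (A' = A ∨ ∑ v ∈ A', r v < ∑ v ∈ A, r v) := by
  have hsA : ∀ k : ℕ, slice i c d A k ⊆ bx (rm i c) (d - k) := fun k => Finset.filter_subset _ _
  have hshA : sh c d A ⊆ bx c (d+1) := Finset.filter_subset _ _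
  have hsS : ∀ k : ℕ, slice i c (d+1) (sh c d A) k ⊆ bx (rm i c) (d + 1 - k) :=
    fun k => Finset.filter_subset _ _
  choose L hL hLc using fun k : ℕ => seg_exists (rm i c) (d - k) _ (Finset.card_le_card (hsA k))
  choose M hM hMc using fun k : ℕ => seg_exists (rm i c) (d + 1 - k) _ (Finset.card_le_card (hsS k))
  have hcA : A.card = ∑ k ∈ Finset.range (c i), (L k).card := by
    simp only [hLc]
    rw [← card_stack hsA, stack_slice hA]
  have hsh : sh c d (stack i c d L) ⊆ stack i c (d+1) M := by
    apply sh_stack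
    · intro k hk
      have h1 := sh_seg (hL k)
      have h2 := hM k
      rw [show d + 1 - (k : ℤ) = d - k + 1 by ring] at h2
      apply seg_sub h1 h2
      refine (hCL _ (rm_mono hc i) _ _ _ (hsA k) (hL k) (hLc k)).trans ?_
      rw [hMc]
      apply Finset.card_le_card
      intro w hw
      rw [mem_sh] at hw
      obtain ⟨hwb, v, hv, j, rfl⟩ := hw
      rw [slice, Finset.mem_filter] at hv ⊢
      rw [show d + 1 - (k : ℤ) = d - k + 1 by ring]
      refine ⟨hwb, ?_⟩
      rw [mem_sh, ins_mem_bx, show d + 1 - (k : ℤ) = d - k + 1 by ring]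
      refine ⟨⟨hk, hwb⟩, _, hv.2, i.succAbove j, ?_⟩
      rw [← ins_rm i (inc (ins i k v) _), inc_sa, rm_ins, inc_ne _ (Fin.succAbove_ne i j).symm, ins_same]
    · intro k hk
      have h2 := hM (k+1)
      rw [show d + 1 - ((k + 1 : ℕ) : ℤ) = d - k by push_cast; ring] at h2
      apply seg_sub (hL k) h2
      rw [hLc, hMc]
      apply Finset.card_le_card
      intro v hv
      rw [slice, Finset.mem_filter] at hv ⊢
      have e : inc (ins i k v) i = ins i (k+1) v := by
        funext j
        rcases fin_cases_sa i j with rfl | ⟨l, rfl⟩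
        · rw [inc_self, ins_same, ins_same]
        · rw [inc_ne _ (Fin.succAbove_ne i l), ins_sa, ins_sa]
      rw [show d + 1 - ((k + 1 : ℕ) : ℤ) = d - k by push_cast; ring]
      refine ⟨hv.1, ?_⟩
      rw [mem_sh, ins_mem_bx, show d + 1 - ((k + 1 : ℕ) : ℤ) = d - k by push_cast; ring]
      exact ⟨⟨hk, hv.1⟩, _, hv.2, i, e.symm⟩
  refine ⟨stack i c d L, Finset.filter_subset _ _, ?_, ?_, ?_, ?_⟩
  · rw [card_stack (fun k => (hL k).1), hcA]
  · refine (Finset.card_le_card hsh).trans ?_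
    rw [card_stack (fun k => (hM k).1)]
    simp only [hMc]
    rw [← card_stack hsS, stack_slice hshA]
  · intro w hw z hz he hl
    rw [mem_stack] at hw ⊢
    refine ⟨hz, ?_⟩
    rw [he]
    refine (hL (w i)).2 _ hw.2 _ ?_ (lx_rm hl he)
    rw [← ins_rm i z, ins_mem_bx, he] at hz
    exact hz.2
  · have key : ∀ k ∈ Finset.range (c i), L k = slice i c d A k ∨
        ∑ v ∈ L k, r (ins i k v) < ∑ v ∈ slice i c d A k, r (ins i k v) := by
      intro k hk
      rw [Finset.mem_range] at hk
      apply seg_sum (hL k) (hsA k) (hLc k)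
      intro v hv w hw h
      exact hr _ (ins_mem_bx.2 ⟨hk, hv⟩) _ (ins_mem_bx.2 ⟨hk, hw⟩) (lx_ins h)
    by_cases hall : ∀ k ∈ Finset.range (c i), L k = slice i c d A k
    · left
      rw [← stack_slice (i := i) hA]
      ext w
      rw [mem_stack, mem_stack]
      refine and_congr_right fun hw => ?_
      rw [hall _ (Finset.mem_range.2 ((mem_bx.1 hw).1 i))]
    · right
      push Not at hall
      obtain ⟨k, hk, hne⟩ := hall
      rw [sum_stack (fun k => (hL k).1)]
      conv_rhs => rw [← stack_slice (i := i) hA]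
      rw [sum_stack hsA]
      apply Finset.sum_lt_sum
      · intro k hk
        rcases key k hk with h | h
        · rw [h]
        · exact h.le
      · exact ⟨k, hk, (key k hk).resolve_left hne⟩

theorem CL_all (n : ℕ) : CL n := by
  classical
  induction n with
  | zero => intro c _ d A L hA hL hcard; exact CL_small (by omega) hA hL hcard
  | succ m ih =>
    intro c hc d A L hA hL hcard
    rcases Nat.lt_or_ge m 2 with hm | hm
    · interval_cases m
      · exact CL_small (by omega) hA hL hcard
      · exact CL_two (hc (by simp)) hA hL hcard
    let r : (Fin (m+1) → ℕ) → ℕ := fun w => ((bx c d).filter (fun z => lx w z)).card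
    have hr : ∀ v ∈ bx c d, ∀ w ∈ bx c d, lx v w → r w < r v := by
      intro v hv w hw h
      apply Finset.card_lt_card
      rw [Finset.ssubset_iff_of_subset]
      · exact ⟨w, by simp [hw, h], by simp [lx_irrefl]⟩
      · intro z hz
        rw [Finset.mem_filter] at *
        exact ⟨hz.1, lx_trans h hz.2⟩
    -- minimal potential
    have main : ∀ N : ℕ, ∀ A ⊆ bx c d, L.card = A.card → ∑ v ∈ A, r v = N →
        (sh c d L).card ≤ (sh c d A).card := by
      intro N
      induction N using Nat.strong_induction_on with
      | _ N ihN =>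
        intro A hA hcard hN
        by_cases hall : ∀ i, Cmp c d A i
        · exact final_compare hA (hall _) (cmp_exch hm hA hall) hL hcard
        · push Not at hall
          obtain ⟨i, hi⟩ := hall
          obtain ⟨A', hA', hc', hs', hC', hor⟩ := compress ih hc i hA r hr
          rcases hor with e | e
          · rw [e] at hC'; exact absurd hC' hi
          · exact (ihN _ (hN ▸ e) A' hA' (by omega) rfl).trans hs'
    exact main _ A hA hcard rfl

def mon (n : ℕ) (d : ℤ) : Finset (Fin n → ℕ) := bx (fun _ => d.toNat + 1) d

lemma le_deg {n : ℕ} (v : Fin n → ℕ) (i : Fin n) : (v i : ℤ) ≤ deg v :=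
  Finset.single_le_sum (f := fun i => (v i : ℤ)) (fun j _ => by positivity) (Finset.mem_univ i)

lemma mem_mon {n : ℕ} {d : ℤ} {v : Fin n → ℕ} : v ∈ mon n d ↔ deg v = d := by
  rw [mon, mem_bx]
  refine ⟨fun h => h.2, fun h => ⟨fun i => ?_, h⟩⟩
  have := le_deg v i
  omega

open scoped Classical in
noncomputable def H {n : ℕ} (I : Set (Fin n → ℕ)) (d : ℤ) : ℕ :=
  ((mon n d).filter (fun v => v ∉ I)).card

lemma H_anti {n : ℕ} {I I' : Set (Fin n → ℕ)} (h : I ⊆ I') (d : ℤ) : H I' d ≤ H I d := by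
  classical
  unfold H
  apply Finset.card_le_card
  intro v hv
  rw [Finset.mem_filter] at *
  exact ⟨hv.1, fun hc => hv.2 (h hc)⟩

def cap {n : ℕ} (t D N : ℕ) : Fin n → ℕ := fun i => if i.val < t then D else N

lemma cap_mono {n t D N : ℕ} (h : D ≤ N) : Monotone (cap (n := n) t D N) := by
  intro i j hij
  have : i.val ≤ j.val := hij
  unfold cap
  split_ifs <;> omega

lemma rm_cap {m t D N : ℕ} : rm 0 (cap (n := m+1) (t+1) D N) = cap t D N := by
  funext j
  simp [rm, cap]

def Cond (n t D : ℕ) (I : Set (Fin n → ℕ)) : Prop :=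
  ∀ B : Finset (Fin n), B.card + t = n + 1 → ∃ u ∈ I, (∀ i, i ∉ B → u i = 0) ∧ deg u = D

lemma seq_exists {m : ℕ} (F : (Fin (m+1) → ℕ) → Fin (m+1) → ℕ) (f : Fin (m+1) → ℕ) (D : ℕ) :
    ∀ u0 : Fin (m+1) → ℕ, u0 ≤ f → deg f = deg u0 + D →
    ∃ (a : ℕ → Fin (m+1)) (u : ℕ → Fin (m+1) → ℕ), u 0 = u0 ∧ (∀ k, u (k+1) = inc (u k) (a k)) ∧
      u D = f ∧ (∀ k, k < D → u k (a k) < f (a k)) ∧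
      ∀ k, k + 1 < D → F (u k) (a (k+1)) ≤ F (u k) (a k) := by
  induction D with
  | zero =>
    intro u0 hle hd
    refine ⟨fun _ => 0, fun k => Nat.rec u0 (fun _ u => inc u 0) k, rfl, fun k => rfl, ?_, ?_, ?_⟩
    · exact eq_of_le_of_deg (v := u0) (w := f) hle (by simp at hd; omega)
    · intro k hk; omega
    · intro k hk; omega
  | succ D ih =>
    intro u0 hle hd
    have hne : (Finset.univ.filter (fun i => u0 i < f i)).Nonempty := by
      by_contra hc
      rw [Finset.not_nonempty_iff_eq_empty, Finset.filter_eq_empty_iff] at hc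
      have : u0 = f := by
        funext i
        have := hc (Finset.mem_univ i)
        have : u0 i ≤ f i := hle i
        omega
      rw [this] at hd
      push_cast at hd
      omega
    obtain ⟨a0, ha0, hmax⟩ := Finset.exists_max_image _ (F u0) hne
    simp only [Finset.mem_filter, Finset.mem_univ, true_and] at ha0 hmax
    obtain ⟨a, u, h0, hs, hD, hlt, hF⟩ := ih (inc u0 a0) (by
        intro i
        have : u0 i ≤ f i := hle i
        change inc u0 a0 i ≤ f i
        unfold inc
        split_ifs with h
        · subst h; omega
        · exact this) (by rw [deg_inc]; push_cast at hd; omega)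
    refine ⟨fun k => Nat.casesOn k a0 a, fun k => Nat.casesOn k u0 u, rfl, ?_, hD, ?_, ?_⟩
    · intro k
      cases k with
      | zero => exact h0
      | succ k => exact hs k
    · intro k hk
      cases k with
      | zero => exact ha0
      | succ k => exact hlt k (by omega)
    · intro k hk
      cases k with
      | zero =>
        apply hmax
        have := hlt 0 (by omega)
        rw [h0] at this
        unfold inc at this
        change u0 (a 0) < f (a 0)
        split_ifs at this <;> omega
      | succ k => exact hF k (by omega)

def piece {m : ℕ} (I : Set (Fin (m+1) → ℕ)) (a : Fin (m+1)) (u : Fin (m+1) → ℕ) :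
    Set (Fin m → ℕ) := {v | ins a 0 v + u ∈ I}

lemma deg_add {n : ℕ} (v w : Fin n → ℕ) : deg (v + w) = deg v + deg w := by
  simp [deg, Finset.sum_add_distrib]

lemma count_step {m : ℕ} (I : Set (Fin (m+1) → ℕ)) (a : Fin (m+1)) (u : Fin (m+1) → ℕ) (d : ℤ) :
    Set.ncard {w | deg w = d ∧ w ∉ I ∧ u ≤ w} =
      H (piece I a u) (d - deg u) + Set.ncard {w | deg w = d ∧ w ∉ I ∧ inc u a ≤ w} := by
  classical
  have fin : {w : Fin (m+1) → ℕ | deg w = d}.Finite := by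
    refine (mon (m+1) d).finite_toSet.subset ?_
    intro w hw
    exact mem_mon.2 hw
  have e1 : {w | deg w = d ∧ w ∉ I ∧ u ≤ w} =
      {w | deg w = d ∧ w ∉ I ∧ u ≤ w ∧ w a = u a} ∪ {w | deg w = d ∧ w ∉ I ∧ inc u a ≤ w} := by
    ext w
    simp only [Set.mem_ofPred_eq, Set.mem_union]
    constructor
    · rintro ⟨h1, h2, h3⟩
      by_cases h : w a = u a
      · exact Or.inl ⟨h1, h2, h3, h⟩
      · refine Or.inr ⟨h1, h2, fun i => ?_⟩
        have : u i ≤ w i := h3 i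
        change inc u a i ≤ w i
        unfold inc
        split_ifs with hi
        · subst hi; omega
        · exact this
    · rintro (⟨h1, h2, h3, _⟩ | ⟨h1, h2, h3⟩)
      · exact ⟨h1, h2, h3⟩
      · refine ⟨h1, h2, fun i => ?_⟩
        have : inc u a i ≤ w i := h3 i
        change u i ≤ w i
        unfold inc at this
        split_ifs at this <;> omega
  rw [e1, Set.ncard_union_eq ?_ (fin.subset fun w hw => hw.1) (fin.subset fun w hw => hw.1)]
  · congr 1
    rw [H, ← Set.ncard_coe_finset]
    symm
    refine Set.ncard_congr (fun v _ => ins a 0 v + u) ?_ ?_ ?_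
    · intro v hv
      simp only [Finset.coe_filter, Set.mem_ofPred_eq, mem_mon] at hv
      refine ⟨?_, hv.2, ?_, ?_⟩
      · rw [deg_add, deg_ins, hv.1]; push_cast; ring
      · intro i; simp
      · simp [ins_same]
    · intro v w _ _ h
      have h' := add_right_cancel h
      rw [← rm_ins a 0 v, h', rm_ins]
    · rintro w ⟨h1, h2, h3, h4⟩
      have e : ins a 0 (rm a (w - u)) + u = w := by
        have : ins a 0 (rm a (w - u)) = w - u := by
          conv_rhs => rw [← ins_rm a (w - u)]
          congr 1
          simp [h4]
        rw [this]
        exact tsub_add_cancel_of_le h3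
      refine ⟨rm a (w - u), ?_, e⟩
      simp only [Finset.coe_filter, Set.mem_ofPred_eq, mem_mon]
      refine ⟨?_, ?_⟩
      · have := congrArg deg e
        rw [deg_add, deg_ins, h1] at this
        push_cast at this
        omega
      · change ¬ (ins a 0 (rm a (w - u)) + u ∈ I)
        rw [e]; exact h2
  · rw [Set.disjoint_left]
    rintro w ⟨_, _, _, h4⟩ ⟨_, _, h3⟩
    have : inc u a a ≤ w a := h3 a
    rw [inc_self] at this
    omega

lemma count_all {m : ℕ} {I : Set (Fin (m+1) → ℕ)} (hI : IsUpperSet I) {D : ℕ}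
    {a : ℕ → Fin (m+1)} {u : ℕ → Fin (m+1) → ℕ} (h0 : u 0 = 0)
    (hs : ∀ k, u (k+1) = inc (u k) (a k)) (hD : u D ∈ I) (d : ℤ) :
    H I d = ∑ k ∈ Finset.range D, H (piece I (a k) (u k)) (d - k) := by
  classical
  have hdeg : ∀ k : ℕ, deg (u k) = k := by
    intro k
    induction k with
    | zero => rw [h0]; simp [deg]
    | succ k ih => rw [hs, deg_inc, ih]; push_cast; rfl
  have key : ∀ K, H I d = ∑ k ∈ Finset.range K, H (piece I (a k) (u k)) (d - k) +
      Set.ncard {w | deg w = d ∧ w ∉ I ∧ u K ≤ w} := by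
    intro K
    induction K with
    | zero =>
      rw [H, ← Set.ncard_coe_finset]
      simp only [Finset.range_zero, Finset.sum_empty, zero_add]
      congr 1
      ext w
      simp [mem_mon, h0]
    | succ K ih =>
      rw [ih, count_step I (a K), Finset.sum_range_succ, hdeg, hs]
      ring
  rw [key D]
  have : {w | deg w = d ∧ w ∉ I ∧ u D ≤ w} = ∅ := by
    ext w
    simp only [Set.mem_ofPred_eq, Set.mem_empty_iff_false, iff_false]
    rintro ⟨_, h1, h2⟩
    exact h1 (hI h2 hD)
  rw [this]; simp

lemma piece_upper {m : ℕ} {I : Set (Fin (m+1) → ℕ)} (hI : IsUpperSet I) (a : Fin (m+1))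
    (u : Fin (m+1) → ℕ) : IsUpperSet (piece I a u) := by
  intro v w h hv
  refine hI ?_ hv
  intro i
  rcases fin_cases_sa a i with rfl | ⟨l, rfl⟩
  · simp [ins_same]
  · simp only [Pi.add_apply, ins_sa]
    have : v l ≤ w l := h l
    omega

lemma piece_cond {m t D : ℕ} {I : Set (Fin (m+1) → ℕ)} (hI : IsUpperSet I)
    (hC : Cond (m+1) (t+1) D I) (a : Fin (m+1)) (u : Fin (m+1) → ℕ) :
    Cond m t D (piece I a u) := by
  intro B hB
  obtain ⟨x, hx, hsupp, hdeg⟩ := hC (B.map a.succAboveEmb) (by rw [Finset.card_map]; omega)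
  have hxa : x a = 0 := by
    apply hsupp
    intro h
    obtain ⟨l, _, hl⟩ := Finset.mem_map.1 h
    exact Fin.succAbove_ne a l hl
  have e : ins a 0 (rm a x) = x := by
    conv_rhs => rw [← ins_rm a x, hxa]
  refine ⟨rm a x, ?_, ?_, ?_⟩
  · change ins a 0 (rm a x) + u ∈ I
    rw [e]
    exact hI (by intro i; simp) hx
  · intro i hi
    apply hsupp
    intro h
    obtain ⟨l, hl, hl'⟩ := Finset.mem_map.1 h
    have : l = i := Fin.succAbove_right_injective (p := a) hl'
    exact hi (this ▸ hl)
  · have := deg_ins a 0 (rm a x)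
    rw [e, hdeg] at this
    push_cast at this
    omega

lemma stack_full {m : ℕ} (i : Fin (m+1)) (c : Fin (m+1) → ℕ) (d : ℤ) :
    (bx c d).card = ∑ k ∈ Finset.range (c i), (bx (rm i c) (d - k)).card := by
  rw [← card_stack (fun k => Finset.Subset.refl _)]
  congr 1
  ext w
  rw [mem_stack]
  refine ⟨fun h => ⟨h, ?_⟩, fun h => h.1⟩
  rw [← ins_rm i w, ins_mem_bx] at h
  exact h.2

lemma H_add {n : ℕ} (I : Set (Fin n → ℕ)) (d : ℤ) (N : ℕ) (h : d < N) (D : ℕ) :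
    ∃ A ⊆ bx (cap (n := n) 0 D N) d, (∀ v, v ∈ A ↔ deg v = d ∧ v ∈ I) ∧
      H I d + A.card = (bx (cap (n := n) 0 D N) d).card := by
  classical
  have e : bx (cap (n := n) 0 D N) d = mon n d := by
    ext v
    rw [mem_mon, mem_bx]
    refine ⟨fun h => h.2, fun h => ⟨fun i => ?_, h⟩⟩
    have := le_deg v i
    simp only [cap, Nat.not_lt_zero, if_false]
    omega
  rw [e]
  refine ⟨(mon n d).filter (fun v => v ∈ I), Finset.filter_subset _ _, ?_, ?_⟩
  · intro v; rw [Finset.mem_filter, mem_mon]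
  · rw [H, add_comm]
    exact Finset.card_filter_add_card_filter_not _

lemma main_zero {n : ℕ} (D : ℕ) (I : Set (Fin n → ℕ)) (hI : IsUpperSet I) (N : ℕ) (hN : D ≤ N) :
    (∀ d : ℤ, d < N → H I d ≤ (bx (cap (n := n) 0 D N) d).card) ∧
    (∀ d : ℤ, d + 1 < N → ∀ L : Finset (Fin n → ℕ), IsSeg (cap 0 D N) d L →
      H I d + L.card = (bx (cap (n := n) 0 D N) d).card →
      H I (d+1) + (sh (cap 0 D N) d L).card ≤ (bx (cap (n := n) 0 D N) (d+1)).card) := by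
  constructor
  · intro d hd
    obtain ⟨A, _, _, h⟩ := H_add I d N hd D
    omega
  · intro d hd L hL hcard
    obtain ⟨A, hA, hmA, h⟩ := H_add I d N (by omega) D
    obtain ⟨A', hA', hmA', h'⟩ := H_add I (d+1) N hd D
    have h1 := CL_all n _ (cap_mono hN) d A L hA hL (by omega)
    have h2 : sh (cap 0 D N) d A ⊆ A' := by
      intro w hw
      rw [mem_sh] at hw
      obtain ⟨hwb, v, hv, j, rfl⟩ := hw
      rw [hmA']
      refine ⟨(mem_bx.1 hwb).2, hI ?_ ((hmA v).1 hv).2⟩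
      intro i
      change v i ≤ inc v j i
      unfold inc
      split_ifs <;> omega
    have := Finset.card_le_card h2
    omega

theorem main_ineq (n : ℕ) : ∀ (t D : ℕ) (I : Set (Fin n → ℕ)), t ≤ n → IsUpperSet I →
    Cond n t D I → ∀ N : ℕ, D ≤ N →
    (∀ d : ℤ, d < N → H I d ≤ (bx (cap (n := n) t D N) d).card) ∧
    (∀ d : ℤ, d + 1 < N → ∀ L : Finset (Fin n → ℕ), IsSeg (cap t D N) d L →
      H I d + L.card = (bx (cap (n := n) t D N) d).card →
      H I (d+1) + (sh (cap t D N) d L).card ≤ (bx (cap (n := n) t D N) (d+1)).card) := by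
  classical
  induction n with
  | zero =>
    intro t D I ht hI hC N hN
    obtain rfl : t = 0 := by omega
    exact main_zero D I hI N hN
  | succ m ih =>
    intro t D I ht hI hC N hN
    cases t with
    | zero => exact main_zero D I hI N hN
    | succ t =>
      have hc0 : cap (n := m+1) (t+1) D N 0 = D := by simp [cap]
      -- a monomial of degree `D` in `I`
      obtain ⟨f, hf, hfd⟩ : ∃ f ∈ I, deg f = D := by
        obtain ⟨B, -, hB⟩ := Finset.exists_subset_card_eq
          (s := (Finset.univ : Finset (Fin (m+1)))) (n := m + 1 - t) (by simp)
        obtain ⟨u, hu, _, hd⟩ := hC B (by omega)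
        exact ⟨u, hu, hd⟩
      have pc : ∀ a u, _ := fun a u => ih t D (piece I a u) (by omega) (piece_upper hI a u)
        (piece_cond hI hC a u) N hN
      constructor
      · intro d hd
        obtain ⟨a, u, h0, hs, hD, -, -⟩ := seq_exists (fun _ _ => 0) f D 0
          (fun i => Nat.zero_le _) (by rw [hfd]; simp [deg])
        rw [count_all hI h0 hs (hD ▸ hf), stack_full 0, hc0, rm_cap]
        apply Finset.sum_le_sum
        intro k _
        exact (pc _ _).1 _ (by omega)
      · intro d hd L hL hcard
        obtain ⟨a, u, h0, hs, hD, -, hF⟩ := seq_exists (fun u b => H (piece I b u) (d - deg u)) f D 0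
          (fun i => Nat.zero_le _) (by rw [hfd]; simp [deg])
        have hdeg : ∀ k : ℕ, deg (u k) = k := by
          intro k
          induction k with
          | zero => rw [h0]; simp [deg]
          | succ k ih => rw [hs, deg_inc, ih]; push_cast; rfl
        have b1 : ∀ k : ℕ, H (piece I (a k) (u k)) (d - k) ≤
            (bx (rm 0 (cap (n := m+1) (t+1) D N)) (d - k)).card := fun k => by
          rw [rm_cap]; exact (pc _ _).1 _ (by omega)
        have b2 : ∀ k : ℕ, H (piece I (a k) (u k)) (d + 1 - k) ≤
            (bx (rm 0 (cap (n := m+1) (t+1) D N)) (d + 1 - k)).card := fun k => by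
          rw [rm_cap]; exact (pc _ _).1 _ (by omega)
        choose P hP hPc using fun k : ℕ => seg_exists (rm 0 (cap (n := m+1) (t+1) D N)) (d - k)
          _ (Nat.sub_le _ (H (piece I (a k) (u k)) (d - k)))
        choose M hM hMc using fun k : ℕ => seg_exists (rm 0 (cap (n := m+1) (t+1) D N)) (d + 1 - k)
          _ (Nat.sub_le _ (H (piece I (a k) (u k)) (d + 1 - k)))
        have hsub : sh (cap (t+1) D N) d (stack 0 (cap (t+1) D N) d P) ⊆
            stack 0 (cap (t+1) D N) (d+1) M := by
          apply sh_stack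
          · intro k _
            have h1 := sh_seg (hP k)
            have h2 := hM k
            have h3 := hMc k
            have h4 := b2 k
            rw [show d + 1 - (k : ℤ) = d - k + 1 by ring] at h2 h3 h4
            apply seg_sub h1 h2
            have h5 := hP k
            have h6 := hPc k
            have h7 := b1 k
            rw [rm_cap] at *
            have := (pc (a k) (u k)).2 (d - k) (by omega) (P k) h5 (by omega)
            omega
          · intro k hk
            rw [hc0] at hk
            have h2 := hM (k+1)
            have h3 := hMc (k+1)
            rw [show d + 1 - ((k + 1 : ℕ) : ℤ) = d - k by push_cast; ring] at h2 h3
            apply seg_sub (hP k) h2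
            rw [hPc, h3]
            apply Nat.sub_le_sub_left
            have hle := hF k hk
            simp only [hdeg] at hle
            refine le_trans (H_anti ?_ _) hle
            intro v hv
            refine hI ?_ hv
            intro i
            change (ins (a (k+1)) 0 v) i + u k i ≤ (ins (a (k+1)) 0 v) i + u (k+1) i
            rw [hs]
            unfold inc
            split_ifs <;> omega
        have c1 : H I d + (stack 0 (cap (n := m+1) (t+1) D N) d P).card =
            (bx (cap (n := m+1) (t+1) D N) d).card := by
          rw [count_all hI h0 hs (hD ▸ hf), stack_full 0, card_stack (fun k => (hP k).1), hc0,
            ← Finset.sum_add_distrib]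
          apply Finset.sum_congr rfl
          intro k _
          have := hPc k
          have := b1 k
          omega
        have c2 : H I (d+1) + (stack 0 (cap (n := m+1) (t+1) D N) (d+1) M).card =
            (bx (cap (n := m+1) (t+1) D N) (d+1)).card := by
          rw [count_all hI h0 hs (hD ▸ hf), stack_full 0, card_stack (fun k => (hM k).1), hc0,
            ← Finset.sum_add_distrib]
          apply Finset.sum_congr rfl
          intro k _
          have := hMc k
          have := b2 k
          omega
        have := CL_all (m+1) _ (cap_mono hN) d (stack 0 (cap (t+1) D N) d P) L
          (Finset.filter_subset _ _) hL (by omega)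
        have := Finset.card_le_card hsub
        omega

lemma upper_of_inc {n : ℕ} {M : Set (Fin n → ℕ)} (h : ∀ s ∈ M, ∀ j, inc s j ∈ M) :
    IsUpperSet M := by
  have key : ∀ k : ℕ, ∀ v w : Fin n → ℕ, v ≤ w → deg w = deg v + k → v ∈ M → w ∈ M := by
    intro k
    induction k with
    | zero =>
      intro v w hvw hd hv
      have := eq_of_le_of_deg (v := v) (w := w) hvw (by rw [hd]; simp)
      rwa [← this]
    | succ k ih =>
      intro v w hvw hd hv
      have hex : ∃ j, v j < w j := by
        by_contra hc
        push Not at hc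
        have : w = v := eq_of_le_of_deg (v := w) (w := v) hc (by rw [hd]; push_cast; omega)
        rw [this] at hd
        push_cast at hd
        omega
      obtain ⟨j, hj⟩ := hex
      refine ih (inc v j) w ?_ (by rw [deg_inc, hd]; push_cast; ring) (h v hv j)
      intro i
      have h1 : v i ≤ w i := hvw i
      by_cases hij : i = j
      · subst hij; rw [inc_self]; exact hj
      · rw [inc_ne v hij]; exact h1
  intro v w hvw hv
  have h1 : deg v ≤ deg w := Finset.sum_le_sum fun i _ => by exact_mod_cast hvw i
  exact key (deg w - deg v).toNat v w hvw (by omega) hv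

lemma deg_nonneg {n : ℕ} (v : Fin n → ℕ) : 0 ≤ deg v := Finset.sum_nonneg fun i _ => by positivity

lemma bx_cap {n t D N N' : ℕ} {d : ℤ} (h : d < N) (h' : d < N') :
    bx (cap (n := n) t D N) d = bx (cap t D N') d := by
  ext v
  simp only [mem_bx]
  refine and_congr_left fun hd => forall_congr' fun i => ?_
  have := le_deg v i
  unfold cap
  split_ifs
  · rfl
  · constructor <;> intro <;> omega

theorem concl {n t D : ℕ} (I : Set (Fin n → ℕ)) (ht : t ≤ n) (hI : IsUpperSet I)
    (hC : Cond n t D I) : ∃ M : Set (Fin n → ℕ), IsUpperSet M ∧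
      (∀ i : Fin n, i.val < t → ∀ s : Fin n → ℕ, D ≤ s i → s ∈ M) ∧ ∀ d : ℕ, H M d = H I d := by
  classical
  have hex : ∀ d : ℕ, ∃ L, IsSeg (cap (n := n) t D (D+d+2)) (d : ℤ) L ∧
      H I d + L.card = (bx (cap (n := n) t D (D+d+2)) (d : ℤ)).card := by
    intro d
    have h1 := (main_ineq n t D I ht hI hC (D+d+2) (by omega)).1 d (by push_cast; omega)
    obtain ⟨L, hL, hc⟩ := seg_exists (cap (n := n) t D (D+d+2)) d
      ((bx (cap (n := n) t D (D+d+2)) (d : ℤ)).card - H I d) (by omega)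
    exact ⟨L, hL, by omega⟩
  choose L hL hcard using hex
  have hstep : ∀ d : ℕ, sh (cap (n := n) t D (D+(d+1)+2)) d (L d) ⊆ L (d+1) := by
    intro d
    have e : bx (cap (n := n) t D (D+d+2)) (d:ℤ) = bx (cap t D (D+(d+1)+2)) d :=
      bx_cap (by push_cast; omega) (by push_cast; omega)
    have hs : IsSeg (cap (n := n) t D (D+(d+1)+2)) (d : ℤ) (L d) := by
      have := hL d
      unfold IsSeg at *
      rwa [e] at this
    have h2 := (main_ineq n t D I ht hI hC (D+(d+1)+2) (by omega)).2 d (by push_cast; omega) (L d) hs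
      (by rw [← e]; exact hcard d)
    have h3 := hcard (d+1)
    have h4 := hL (d+1)
    push_cast at h3 h4
    exact seg_sub (sh_seg hs) h4 (by omega)
  refine ⟨{s | (∃ i : Fin n, i.val < t ∧ D ≤ s i) ∨ s ∈ L (deg s).toNat}, ?_, ?_, ?_⟩
  · apply upper_of_inc
    rintro s hs j
    by_cases hb : ∃ i : Fin n, i.val < t ∧ D ≤ inc s j i
    · exact Or.inl hb
    right
    rcases hs with ⟨i, hi, hD⟩ | hs
    · exact absurd ⟨i, hi, hD.trans (by unfold inc; split_ifs <;> omega)⟩ hb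
    · have h0 := deg_nonneg s
      have e : (deg (inc s j)).toNat = (deg s).toNat + 1 := by rw [deg_inc]; omega
      rw [e]
      apply hstep
      rw [mem_sh]
      refine ⟨?_, s, hs, j, rfl⟩
      rw [mem_bx]
      refine ⟨fun i => ?_, by rw [deg_inc]; omega⟩
      push Not at hb
      have h5 := hb i
      have h6 := le_deg (inc s j) i
      rw [deg_inc] at h6
      unfold cap
      split_ifs with h7
      · exact h5 h7
      · omega
  · intro i hi s hs
    exact Or.inl ⟨i, hi, hs⟩
  · intro d
    have h1 := hcard d
    have h2 : H {s | (∃ i : Fin n, i.val < t ∧ D ≤ s i) ∨ s ∈ L (deg s).toNat} d =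
        (bx (cap (n := n) t D (D+d+2)) (d : ℤ) \ L d).card := by
      unfold H
      congr 1
      ext v
      simp only [Finset.mem_filter, mem_mon, Finset.mem_sdiff, mem_bx]
      constructor
      · rintro ⟨hd, hv⟩
        have hv1 : ¬ ((∃ i : Fin n, i.val < t ∧ D ≤ v i) ∨ v ∈ L (deg v).toNat) := hv
        rw [hd] at hv1
        push Not at hv1
        refine ⟨⟨fun i => ?_, hd⟩, by simpa using hv1.2⟩
        have h5 := hv1.1 i
        have h6 := le_deg v i
        unfold cap
        split_ifs with h7
        · exact h5 h7
        · omega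
      · rintro ⟨⟨hv, hd⟩, hL'⟩
        refine ⟨hd, ?_⟩
        rintro (⟨i, hi, hD⟩ | h)
        · have := hv i
          simp only [cap, hi, if_true] at this
          omega
        · rw [hd] at h
          exact hL' (by simpa using h)
    rw [h2, Finset.card_sdiff_of_subset (hL d).1]
    omega

lemma deg_eq_degree {n : ℕ} (m : Fin n →₀ ℕ) : deg (m : Fin n → ℕ) = (m.degree : ℤ) := by
  rw [Finsupp.degree_eq_sum]
  simp [deg]

def mset {n : ℕ} {K : Type*} [Field K] (I : Ideal (MvPolynomial (Fin n) K)) : Set (Fin n → ℕ) :=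
  {v | monomial (Finsupp.equivFunOnFinite.symm v) (1 : K) ∈ I}

lemma mem_mset {n : ℕ} {K : Type*} [Field K] {I : Ideal (MvPolynomial (Fin n) K)}
    {m : Fin n →₀ ℕ} : (m : Fin n → ℕ) ∈ mset I ↔ monomial m (1 : K) ∈ I := by
  have : Finsupp.equivFunOnFinite.symm (m : Fin n → ℕ) = m := by ext; simp
  change monomial (Finsupp.equivFunOnFinite.symm (m : Fin n → ℕ)) (1 : K) ∈ I ↔ _
  rw [this]

lemma mem_iff {n : ℕ} {K : Type*} [Field K] {I : Ideal (MvPolynomial (Fin n) K)}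
    (hI : IsMonomialIdeal I) (f : MvPolynomial (Fin n) K) :
    f ∈ I ↔ ∀ m ∈ f.support, monomial m (1 : K) ∈ I := by
  classical
  obtain ⟨G, rfl⟩ := hI
  simp only [mem_ideal_span_monomial_image]
  refine forall₂_congr fun m _ => ?_
  rw [support_monomial]
  simp

lemma mset_upper {n : ℕ} {K : Type*} [Field K] (I : Ideal (MvPolynomial (Fin n) K)) :
    IsUpperSet (mset I) := by
  intro v w hvw hv
  have h : (monomial (Finsupp.equivFunOnFinite.symm v) (1 : K)) ∣
      monomial (Finsupp.equivFunOnFinite.symm w) (1 : K) := by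
    rw [monomial_dvd_monomial]
    refine ⟨Or.inr fun i => ?_, dvd_rfl⟩
    simpa using hvw i
  exact I.mem_of_dvd h hv

lemma hilb {n : ℕ} {K : Type*} [Field K] {I : Ideal (MvPolynomial (Fin n) K)}
    (hI : IsMonomialIdeal I) (d : ℕ) : hilbertFn K I d = H (mset I) d := by
  classical
  set T := (mon n (d : ℤ)).filter (fun v => v ∉ mset I) with hT
  let φ : ↥(homogeneousSubmodule (Fin n) K d) →ₗ[K] (T → K) :=
    LinearMap.pi fun v => (lcoeff K (Finsupp.equivFunOnFinite.symm (v : Fin n → ℕ))) ∘ₗ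
      (homogeneousSubmodule (Fin n) K d).subtype
  have hφ : ∀ f v, φ f v = coeff (Finsupp.equivFunOnFinite.symm (v : Fin n → ℕ)) (f : MvPolynomial (Fin n) K) :=
    fun f v => rfl
  have hs : Function.Surjective φ := by
    intro g
    refine ⟨⟨∑ v : T, monomial (Finsupp.equivFunOnFinite.symm (v : Fin n → ℕ)) (g v), ?_⟩, ?_⟩
    · refine Submodule.sum_mem _ fun v _ => ?_
      rw [mem_homogeneousSubmodule]
      apply isHomogeneous_monomial
      have h1 : deg (v : Fin n → ℕ) = d := mem_mon.1 (Finset.mem_filter.1 v.2).1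
      have h2 := deg_eq_degree (Finsupp.equivFunOnFinite.symm (v : Fin n → ℕ))
      rw [Finsupp.coe_equivFunOnFinite_symm, h1] at h2
      exact_mod_cast h2.symm
    · funext v
      rw [hφ]
      simp only [coeff_sum, coeff_monomial]
      rw [Finset.sum_eq_single v]
      · simp
      · intro w _ hw
        rw [if_neg]
        intro h
        exact hw (Subtype.ext (Finsupp.equivFunOnFinite.symm.injective h))
      · simp
  have hk : Submodule.comap (homogeneousSubmodule (Fin n) K d).subtype
        (Submodule.restrictScalars K I) = LinearMap.ker φ := by
    ext f
    rw [Submodule.mem_comap, LinearMap.mem_ker, Submodule.restrictScalars_mem, mem_iff hI]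
    constructor
    · intro h
      funext v
      rw [hφ]
      by_contra hc
      have h1 := h _ (mem_support_iff.2 hc)
      exact (Finset.mem_filter.1 v.2).2 h1
    · intro h m hm
      by_contra hc
      have hd : m.degree = d := by
        have := (mem_homogeneousSubmodule d (f : MvPolynomial (Fin n) K)).1 f.2
        have h3 := this (mem_support_iff.1 hm)
        rw [← h3]
        exact congrArg (fun g => g m) (Finsupp.degree_eq_weight_one (R := ℕ) (σ := Fin n))
      have hmT : (m : Fin n → ℕ) ∈ T := by
        rw [hT, Finset.mem_filter, mem_mon, mem_mset, deg_eq_degree, hd]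
        exact ⟨rfl, hc⟩
      have h2 := congrFun h ⟨_, hmT⟩
      rw [hφ] at h2
      have : Finsupp.equivFunOnFinite.symm (m : Fin n → ℕ) = m := by ext; simp
      simp only [this] at h2
      exact mem_support_iff.1 hm h2
  unfold hilbertFn
  rw [hk, (φ.quotKerEquivOfSurjective hs).finrank_eq, Module.finrank_fintype_fun_eq_card,
    Fintype.card_coe]
  rfl

lemma graded_of_monomial {n : ℕ} {K : Type*} [Field K] {I : Ideal (MvPolynomial (Fin n) K)}
    (hI : IsMonomialIdeal I) : IsGradedIdeal I := by
  intro f hf d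
  rw [mem_iff hI] at hf ⊢
  intro m hm
  apply hf
  rw [mem_support_iff, coeff_homogeneousComponent] at hm
  rw [mem_support_iff]
  intro h
  apply hm
  simp [h]

lemma of_upper {n : ℕ} (K : Type*) [Field K] {M : Set (Fin n → ℕ)} (hM : IsUpperSet M) :
    ∃ J : Ideal (MvPolynomial (Fin n) K), IsMonomialIdeal J ∧ mset J = M := by
  classical
  refine ⟨_, ⟨{m | (m : Fin n → ℕ) ∈ M}, rfl⟩, ?_⟩
  ext v
  change monomial (Finsupp.equivFunOnFinite.symm v) (1 : K) ∈ Ideal.span _ ↔ _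
  rw [mem_ideal_span_monomial_image, support_monomial]
  simp only [one_ne_zero, if_false, Finset.mem_singleton, forall_eq]
  constructor
  · rintro ⟨m, hm, h⟩
    refine hM (a := (m : Fin n → ℕ)) (fun i => ?_) hm
    simpa using h i
  · intro h
    refine ⟨_, ?_, le_rfl⟩
    change _ ∈ M
    simpa using h

lemma height_le {n : ℕ} {K : Type*} [Field K] {I : Ideal (MvPolynomial (Fin n) K)}
    (hI : IsMonomialIdeal I) (B : Finset (Fin n))
    (hB : ∀ v ∈ mset I, ∃ i ∉ B, v i ≠ 0) : idealHeight I ≤ (n - B.card : ℕ) := by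
  classical
  set Q : Ideal (MvPolynomial (Fin n) K) := Ideal.span (X '' ((Bᶜ : Finset (Fin n)) : Set (Fin n))) with hQ
  have hIQ : I ≤ Q := by
    intro f hf
    rw [hQ, mem_ideal_span_X_image]
    intro m hm
    obtain ⟨i, hi, h⟩ := hB m (mem_mset.2 ((mem_iff hI f).1 hf m hm))
    exact ⟨i, by simpa using hi, h⟩
  have hQt : Q ≠ ⊤ := by
    rw [Ideal.ne_top_iff_one, hQ, mem_ideal_span_X_image]
    intro h
    obtain ⟨i, _, h⟩ := h 0 (by simp)
    simp at h
  obtain ⟨p, hp⟩ := Ideal.nonempty_minimalPrimes hQt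
  have hpp : p.IsPrime := hp.isPrime
  have hh : p.height ≤ (n - B.card : ℕ) := by
    have e : Q = Ideal.span (((Bᶜ : Finset (Fin n)).image X : Finset (MvPolynomial (Fin n) K)) : Set (MvPolynomial (Fin n) K)) := by
      rw [hQ, Finset.coe_image]
    rw [e] at hp
    refine (Ideal.height_le_card_of_mem_minimalPrimes_span_finset hp).trans ?_
    have := (Finset.card_image_le (s := Bᶜ) (f := (X : Fin n → MvPolynomial (Fin n) K)))
    rw [Finset.card_compl, Fintype.card_fin] at this
    exact_mod_cast this
  refine le_trans (sInf_le ⟨⟨p, hpp⟩, hIQ.trans hp.1.2, rfl⟩) ?_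
  rw [← PrimeSpectrum.height_eq_orderHeight]
  exact hh

lemma bdd {n : ℕ} {K : Type*} [Field K] (I : Ideal (MvPolynomial (Fin n) K)) :
    (minGenDegrees I).Finite := by
  have hf : {s : Fin n →₀ ℕ | Minimal (fun s => monomial s (1 : K) ∈ I) s}.Finite :=
    (setOfPred_minimal_antichain _).finite_of_partiallyWellOrderedOn (Set.isPWO_of_wellQuasiOrderedLE _)
  refine (hf.image (fun s => s.sum (fun _ e => e))).subset ?_
  rintro j ⟨s, h1, h2, h3⟩
  refine ⟨s, ⟨h1, fun s' h h' => (h2 s' h h').ge⟩, h3⟩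

lemma exists_min {n : ℕ} {K : Type*} [Field K] (I : Ideal (MvPolynomial (Fin n) K))
    {v : Fin n → ℕ} (hv : v ∈ mset I) :
    ∃ m : Fin n →₀ ℕ, monomial m (1 : K) ∈ I ∧ (m : Fin n → ℕ) ≤ v ∧ m.degree ∈ minGenDegrees I := by
  obtain ⟨m, hm, hmin⟩ := exists_minimal_le_of_wellFoundedLT
    (fun s : Fin n →₀ ℕ => monomial s (1 : K) ∈ I) (Finsupp.equivFunOnFinite.symm v) hv
  refine ⟨m, hmin.prop, fun i => by simpa using hm i, m, hmin.prop, fun s' h h' => ?_, rfl⟩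
  exact le_antisymm h' (hmin.le_of_le h h')

lemma deg_inc_iter {n : ℕ} {M : Set (Fin n → ℕ)} (hM : IsUpperSet M) {B : Finset (Fin n)}
    {b : Fin n} (hb : b ∈ B) (k : ℕ) (v : Fin n → ℕ) (hv : v ∈ M) (h0 : ∀ i, i ∉ B → v i = 0) :
    ∃ u ∈ M, (∀ i, i ∉ B → u i = 0) ∧ deg u = deg v + k := by
  induction k with
  | zero => exact ⟨v, hv, h0, by simp⟩
  | succ k ih =>
    obtain ⟨u, hu, h1, h2⟩ := ih
    refine ⟨inc u b, hM (fun i => ?_) hu, fun i hi => ?_, ?_⟩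
    · change u i ≤ inc u b i
      unfold inc
      split_ifs <;> omega
    · rw [inc_ne u (by rintro rfl; exact hi hb)]
      exact h1 i hi
    · rw [deg_inc, h2]; push_cast; ring

theorem final {n t : ℕ} (K : Type*) [Field K]
    (I : Ideal (MvPolynomial (Fin n) K)) (hI : IsMonomialIdeal I)
    (hht : idealHeight I = t) :
    ∃ (htn : t ≤ n) (a : Fin t → ℕ), Monotone a ∧
      (∀ i : Fin t, sInf (minGenDegrees I) ≤ a i ∧ a i ≤ sSup (minGenDegrees I)) ∧
      ∃ J : Ideal (MvPolynomial (Fin n) K), IsGradedIdeal J ∧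
        (∀ i : Fin t, (X (Fin.castLE htn i) : MvPolynomial (Fin n) K) ^ a i ∈ J) ∧
        ∀ d : ℕ, hilbertFn K J d = hilbertFn K I d := by
  classical
  have hne : I ≠ ⊤ := by
    rintro rfl
    have : idealHeight (⊤ : Ideal (MvPolynomial (Fin n) K)) = ⊤ := by
      unfold idealHeight
      rw [sInf_eq_top]
      rintro h ⟨p, hp, _⟩
      exact absurd (top_le_iff.1 hp) p.2.ne_top
    rw [this] at hht
    exact absurd hht (by simp)
  have h0 : (0 : Fin n → ℕ) ∉ mset I := by
    intro h
    apply hne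
    rw [Ideal.eq_top_iff_one]
    have h' : ((0 : Fin n →₀ ℕ) : Fin n → ℕ) ∈ mset I := by simpa using h
    exact mem_mset.1 h'
  have htn : t ≤ n := by
    have := height_le hI ∅ (fun v hv => by
      by_contra hc
      push Not at hc
      apply h0
      have : v = 0 := by funext i; exact hc i (by simp)
      rwa [← this])
    rw [hht] at this
    simpa using this
  set D := sSup (minGenDegrees I) with hD
  have hsup : ∀ B : Finset (Fin n), B.card + t = n + 1 →
      ∃ u ∈ mset I, (∀ i, i ∉ B → u i = 0) := by
    intro B hB
    by_contra hc
    push Not at hc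
    have := height_le hI B hc
    rw [hht] at this
    have h1 : t ≤ n - B.card := by exact_mod_cast this
    have h2 : B.card ≤ n := by simpa using B.card_le_univ
    omega
  have hC : Cond n t D (mset I) := by
    intro B hB
    obtain ⟨v, hv, hvB⟩ := hsup B hB
    obtain ⟨m, hm, hmv, hdeg⟩ := exists_min I hv
    have hle : m.degree ≤ D := le_csSup (bdd I).bddAbove hdeg
    have hBne : B.Nonempty := by
      rw [← Finset.card_pos]; omega
    obtain ⟨b, hb⟩ := hBne
    obtain ⟨u, hu, h1, h2⟩ := deg_inc_iter (mset_upper I) hb (D - m.degree) m (mem_mset.2 hm)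
      (fun i hi => by
        have h3 : m i ≤ v i := hmv i
        have := hvB i hi
        omega)
    refine ⟨u, hu, h1, ?_⟩
    rw [h2, deg_eq_degree]
    omega
  obtain ⟨M, hM, hMD, hMH⟩ := concl (mset I) htn (mset_upper I) hC
  obtain ⟨J, hJ, rfl⟩ := of_upper K hM
  refine ⟨htn, fun _ => D, fun _ _ _ => le_rfl, fun i => ⟨?_, le_rfl⟩, J, graded_of_monomial hJ, ?_, ?_⟩
  · have hne' : (minGenDegrees I).Nonempty := by
      have hi := i.2
      obtain ⟨B, _, hB⟩ := Finset.exists_subset_card_eq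
        (s := (Finset.univ : Finset (Fin n))) (n := n + 1 - t) (by simp; omega)
      obtain ⟨v, hv, _⟩ := hsup B (by omega)
      obtain ⟨m, _, _, h⟩ := exists_min I hv
      exact ⟨_, h⟩
    obtain ⟨x, hx⟩ := hne'
    exact (Nat.sInf_le hx).trans (le_csSup (bdd I).bddAbove hx)
  · intro i
    rw [X_pow_eq_monomial]
    rw [← mem_mset]
    exact hMD (Fin.castLE htn i) i.2 _ (by simp)
  · intro d
    rw [hilb hJ, hilb hI, hMH]

end EGH

/-- **Corollary 25 of the paper (EGH for monomial ideals).**  If `I` is a monomial ideal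
of height `t`, then `I` has the same Hilbert function as an ideal containing
`x₁^{a₁},…,x_t^{a_t}` for some `a₁ ≤ ⋯ ≤ a_t` lying between the minimal and the maximal
degree of a minimal monomial generator of `I` (the degrees `j` with `β₁ⱼ(S/I) ≠ 0`). -/
theorem egh_for_monomial_ideals_with_bounds_on_degrees
    {n t : ℕ} (K : Type*) [Field K]
    (I : Ideal (MvPolynomial (Fin n) K)) (hI : IsMonomialIdeal I)
    (hht : idealHeight I = t) :
    ∃ (htn : t ≤ n) (a : Fin t → ℕ), Monotone a ∧
      (∀ i : Fin t, sInf (minGenDegrees I) ≤ a i ∧ a i ≤ sSup (minGenDegrees I)) ∧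
      ∃ J : Ideal (MvPolynomial (Fin n) K), IsGradedIdeal J ∧
        (∀ i : Fin t, (X (Fin.castLE htn i) : MvPolynomial (Fin n) K) ^ a i ∈ J) ∧
        ∀ d : ℕ, hilbertFn K J d = hilbertFn K I d := by
  exact EGH.final K I hI hht
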